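/- Let (Q,R) be a quadratic monomial presentation with B finite, and write H_m for the degree-m homology of the complex k(B⊙Γ). The following are equivalent: (i) there is no complete circuit in (Q,R) (equivalently, the finite-dimensional algebra kQ/⟨R⟩ has finite global dimension); (ii) H_m = 0 for all m ≥ 1; (iii) there exists m₀ such that H_m = 0 for all m ≥ m₀; (iv) there exists m₀ such that ⊕_{m ≥ m₀} H_m is finite-dimensional. -/

import Mathlib

/-!
Common framework: quivers, paths (as a start vertex together with a list of
composable arrows, listed in order of traversal, so that the paper's path
`c_m ⋯ c_1` corresponds to the list `[c_1, …, c_m]`), gentle and quadratic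
monomial presentations, the cochain complex `k(Γ ∥ B)` and the chain complex
`k(B ⊙ Γ)` of the paper.
-/

namespace GentleTT

structure Quiv where
  V : Type
  A : Type
  [fintV : Fintype V]
  [fintA : Fintype A]
  [decV : DecidableEq V]
  [decA : DecidableEq A]
  src : A → V
  tgt : A → V

attribute [instance] Quiv.fintV Quiv.fintA Quiv.decV Quiv.decA

/-- A "path datum": a start vertex together with the list of arrows traversed. -/
abbrev PathDat (Q : Quiv) := Q.V × List Q.A

def psrc (Q : Quiv) (p : PathDat Q) : Q.V := p.1

def ptgt (Q : Quiv) (p : PathDat Q) : Q.V := p.2.getLast?.elim p.1 Q.tgt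

def plen (Q : Quiv) (p : PathDat Q) : ℕ := p.2.length

/-- `p` is a genuine path: consecutive arrows compose, and the recorded start
vertex is the source of the first arrow (if any). -/
def Ok (Q : Quiv) (p : PathDat Q) : Prop :=
  p.2.Chain' (fun a b => Q.tgt a = Q.src b) ∧ ∀ a ∈ p.2.head?, Q.src a = p.1

/-- `p` is a path none of whose length-2 subpaths lies in `R`
(an element of the basis `B` of `kQ/⟨R⟩`). -/
def InB (Q : Quiv) (R : Set (Q.A × Q.A)) (p : PathDat Q) : Prop :=
  Ok Q p ∧ p.2.Chain' (fun a b => (a, b) ∉ R)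

/-- `p` is a path all of whose length-2 subpaths lie in `R` (an element of `Γ`). -/
def InG (Q : Quiv) (R : Set (Q.A × Q.A)) (p : PathDat Q) : Prop :=
  Ok Q p ∧ p.2.Chain' (fun a b => (a, b) ∈ R)

/-- Parallel paths: same source and same target. -/
def Par (Q : Quiv) (p q : PathDat Q) : Prop :=
  psrc Q p = psrc Q q ∧ ptgt Q p = ptgt Q q

/-- Antiparallel paths: `s(p) = t(q)` and `t(p) = s(q)`. -/
def AntiPar (Q : Quiv) (p q : PathDat Q) : Prop :=
  psrc Q p = ptgt Q q ∧ ptgt Q p = psrc Q q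

/-- A cycle: a path of positive length whose source equals its target. -/
def IsCycle (Q : Quiv) (p : PathDat Q) : Prop :=
  Ok Q p ∧ p.2 ≠ [] ∧ psrc Q p = ptgt Q p

/-- Rotation of a cycle: the paper's `rot (c_m ⋯ c_1) = c_{m-1} ⋯ c_1 c_m`
(the last arrow traversed becomes the first one traversed). -/
def rotP (Q : Quiv) (p : PathDat Q) : PathDat Q :=
  match p.2.getLast? with
  | none => p
  | some a => (Q.src a, a :: p.2.dropLast)

/-- Iterated rotation `rot^i`. -/
def rotI (Q : Quiv) (i : ℕ) (p : PathDat Q) : PathDat Q := (rotP Q)^[i] p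

def powL {α : Type} (l : List α) : ℕ → List α
  | 0 => []
  | n + 1 => l ++ powL l n

/-- The `n`-th power `p^n` of a (cyclic) path. -/
def powP (Q : Quiv) (p : PathDat Q) (n : ℕ) : PathDat Q := (p.1, powL p.2 n)

/-- A primitive cycle: a cycle that is not a proper power of another cycle. -/
def IsPrimitive (Q : Quiv) (p : PathDat Q) : Prop :=
  IsCycle Q p ∧ ∀ (q : PathDat Q) (n : ℕ), IsCycle Q q → 2 ≤ n → p ≠ powP Q q n

/-- The period of a cycle: the least `i ≥ 1` with `rot^i p = p`. -/
noncomputable def periodP (Q : Quiv) (p : PathDat Q) : ℕ :=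
  sInf {i : ℕ | 1 ≤ i ∧ rotI Q i p = p}

/-- Two cycles are conjugate (belong to the same circuit) if one is obtained
from the other by iterated rotation. -/
def RotEquiv (Q : Quiv) (p q : PathDat Q) : Prop := ∃ i : ℕ, rotI Q i p = q

/-- A cocomplete cycle: `p² ∈ B`. -/
def Cocomplete (Q : Quiv) (R : Set (Q.A × Q.A)) (p : PathDat Q) : Prop :=
  IsCycle Q p ∧ InB Q R (powP Q p 2)

/-- A complete cycle: `p² ∈ Γ`. -/
def Complete (Q : Quiv) (R : Set (Q.A × Q.A)) (p : PathDat Q) : Prop :=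
  IsCycle Q p ∧ InG Q R (powP Q p 2)

/-- `B`-maximal path: in `B` and not a proper subpath of another element of `B`. -/
def BMax (Q : Quiv) (R : Set (Q.A × Q.A)) (p : PathDat Q) : Prop :=
  InB Q R p ∧ ∀ q : PathDat Q, InB Q R q → p.2 <:+: q.2 → p.2 = q.2

/-- `Γ`-maximal path: in `Γ` and not a proper subpath of another element of `Γ`. -/
def GMax (Q : Quiv) (R : Set (Q.A × Q.A)) (p : PathDat Q) : Prop :=
  InG Q R p ∧ ∀ q : PathDat Q, InG Q R q → p.2 <:+: q.2 → p.2 = q.2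

def Adj (Q : Quiv) (v w : Q.V) : Prop :=
  ∃ a : Q.A, (Q.src a = v ∧ Q.tgt a = w) ∨ (Q.src a = w ∧ Q.tgt a = v)

/-- Connectedness of the underlying graph of the quiver. -/
def Connected (Q : Quiv) : Prop := ∀ v w : Q.V, Relation.ReflTransGen (Adj Q) v w

/-- A quadratic monomial presentation: the relations are paths of length 2. -/
def IsQuadMon (Q : Quiv) (R : Set (Q.A × Q.A)) : Prop :=
  ∀ r ∈ R, Q.tgt r.1 = Q.src r.2

/-- A gentle presentation. -/
structure IsGentle (Q : Quiv) (R : Set (Q.A × Q.A)) : Prop where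
  nonempty : Nonempty Q.V
  connected : Connected Q
  relComposable : ∀ r ∈ R, Q.tgt r.1 = Q.src r.2
  srcLe : ∀ v : Q.V, {a : Q.A | Q.src a = v}.ncard ≤ 2
  tgtLe : ∀ v : Q.V, {a : Q.A | Q.tgt a = v}.ncard ≤ 2
  uniqNotRelAfter : ∀ a : Q.A, {b : Q.A | Q.tgt a = Q.src b ∧ (a, b) ∉ R}.Subsingleton
  uniqNotRelBefore : ∀ a : Q.A, {c : Q.A | Q.tgt c = Q.src a ∧ (c, a) ∉ R}.Subsingleton
  uniqRelAfter : ∀ a : Q.A, {b : Q.A | Q.tgt a = Q.src b ∧ (a, b) ∈ R}.Subsingleton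
  uniqRelBefore : ∀ a : Q.A, {c : Q.A | Q.tgt c = Q.src a ∧ (c, a) ∈ R}.Subsingleton

/-- A spanning tree of the (finite, connected) quiver `Q`: a set of arrows
which connects all vertices and has exactly `|Q₀| - 1` elements. -/
def IsSpanningTree (Q : Quiv) (T : Set Q.A) : Prop :=
  (∀ v w : Q.V, Relation.ReflTransGen
      (fun x y => ∃ a ∈ T, (Q.src a = x ∧ Q.tgt a = y) ∨ (Q.src a = y ∧ Q.tgt a = x)) v w) ∧
  T.ncard + 1 = Fintype.card Q.V

/-- A set of representatives, one for each rotation class of cycles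
satisfying `Pred`. -/
def IsRepSet (Q : Quiv) (P : Set (PathDat Q)) (Pred : PathDat Q → Prop) : Prop :=
  (∀ p ∈ P, Pred p) ∧ ∀ q : PathDat Q, Pred q → ∃! p, p ∈ P ∧ RotEquiv Q q p

/-- `S` is a valid choice of the paper's set `Crep` for the predicate `Pred`
(e.g. cocompleteness, or completeness): it consists of all positive powers of a
chosen set of representatives of the rotation classes of primitive cycles
satisfying `Pred`. -/
def IsCrep (Q : Quiv) (S : Set (PathDat Q)) (Pred : PathDat Q → Prop) : Prop :=
  ∃ P : Set (PathDat Q),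
    IsRepSet Q P (fun p => IsPrimitive Q p ∧ Pred p) ∧
    S = {x | ∃ p ∈ P, ∃ n : ℕ, 1 ≤ n ∧ x = powP Q p n}

/-! ### The cochain complex `k(Γ ∥ B)` -/

/-- Membership in the degree-`m` basis `Γ_m ∥ B` of the cochain complex. -/
def GBmem (Q : Quiv) (R : Set (Q.A × Q.A)) (m : ℕ) (x : PathDat Q × PathDat Q) : Prop :=
  InG Q R x.1 ∧ plen Q x.1 = m ∧ InB Q R x.2 ∧ Par Q x.1 x.2

abbrev GB (Q : Quiv) (R : Set (Q.A × Q.A)) (m : ℕ) :=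
  {x : PathDat Q × PathDat Q // GBmem Q R m x}

/-- The degree-`m` component of the cochain complex `k(Γ ∥ B)`. -/
abbrev Coch (k : Type) [Field k] (Q : Quiv) (R : Set (Q.A × Q.A)) (m : ℕ) :=
  GB Q R m →₀ k

/-- The basis vector of `k(Γ_m ∥ B)` attached to a raw pair of path data
(and `0` if the pair is not in `Γ_m ∥ B`). -/
noncomputable def bv (k : Type) [Field k] (Q : Quiv) (R : Set (Q.A × Q.A)) (m : ℕ)
    (x : PathDat Q × PathDat Q) : Coch k Q R m := by
  classical
  exact if h : GBmem Q R m x then Finsupp.single (⟨x, h⟩ : GB Q R m) (1 : k) else 0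

/-- Extension on the left (in the paper's notation): `p ↦ b p`. -/
def extL (Q : Quiv) (b : Q.A) (p : PathDat Q) : PathDat Q := (p.1, p.2 ++ [b])

/-- Extension on the right (in the paper's notation): `p ↦ p a`. -/
def extR (Q : Quiv) (a : Q.A) (p : PathDat Q) : PathDat Q := (Q.src a, a :: p.2)

/-- The differential on a basis element:
`d^m (γ, α) = Σ_b (bγ, bα) - (-1)^m Σ_a (γa, αa)`. -/
noncomputable def dB (k : Type) [Field k] (Q : Quiv) (R : Set (Q.A × Q.A)) (m : ℕ)
    (x : GB Q R m) : Coch k Q R (m + 1) := by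
  classical
  exact
    (∑ b : Q.A,
      if h : GBmem Q R (m + 1) (extL Q b x.val.1, extL Q b x.val.2) then
        Finsupp.single (⟨_, h⟩ : GB Q R (m + 1)) (1 : k) else 0)
    - ((-1 : k) ^ m) •
      (∑ a : Q.A,
        if h : Q.tgt a = psrc Q x.val.1 ∧
            GBmem Q R (m + 1) (extR Q a x.val.1, extR Q a x.val.2) then
          Finsupp.single (⟨_, h.2⟩ : GB Q R (m + 1)) (1 : k) else 0)

/-- The differential `d^m : k(Γ_m ∥ B) → k(Γ_{m+1} ∥ B)`. -/
noncomputable def dLin (k : Type) [Field k] (Q : Quiv) (R : Set (Q.A × Q.A)) (m : ℕ) :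
    Coch k Q R m →ₗ[k] Coch k Q R (m + 1) :=
  Finsupp.linearCombination k (dB k Q R m)

/-- The element `𝟙 = Σ_{i ∈ Q₀} (e_i, e_i)` (placed in degree `m`; it is the
intended element when `m = 0`). -/
noncomputable def oneD (k : Type) [Field k] (Q : Quiv) (R : Set (Q.A × Q.A)) (m : ℕ) :
    Coch k Q R m :=
  ∑ i : Q.V, bv k Q R m ((i, []), (i, []))

/-- `⟨α⟩ = Σ_{i=0}^{r-1} (s(rot^i α), rot^i α)`, `r` the period of `α`. -/
noncomputable def cycB (k : Type) [Field k] (Q : Quiv) (R : Set (Q.A × Q.A)) (m : ℕ)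
    (α : PathDat Q) : Coch k Q R m :=
  ∑ i ∈ Finset.range (periodP Q α),
    bv k Q R m ((psrc Q (rotI Q i α), []), rotI Q i α)

/-- `⟨C⟩ = Σ_{i=0}^{r-1} (-1)^{i m} (rot^i C, s(rot^i C))`, `r` the period of `C`. -/
noncomputable def cycG (k : Type) [Field k] (Q : Quiv) (R : Set (Q.A × Q.A)) (m : ℕ)
    (C : PathDat Q) : Coch k Q R m :=
  ∑ i ∈ Finset.range (periodP Q C),
    ((-1 : k) ^ (i * m)) • bv k Q R m (rotI Q i C, (psrc Q (rotI Q i C), []))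

/-- The coboundary subspace in degree `m` (zero in degree `0`). -/
noncomputable def cobSp (k : Type) [Field k] (Q : Quiv) (R : Set (Q.A × Q.A)) :
    (m : ℕ) → Submodule k (Coch k Q R m)
  | 0 => ⊥
  | m + 1 => LinearMap.range (dLin k Q R m)

/-- The cocycle subspace in degree `m`. -/
noncomputable def cocSp (k : Type) [Field k] (Q : Quiv) (R : Set (Q.A × Q.A)) (m : ℕ) :
    Submodule k (Coch k Q R m) :=
  LinearMap.ker (dLin k Q R m)

/-- The degree-`m` cohomology `HH^m` of the complex `k(Γ ∥ B)` vanishes: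
every cocycle is a coboundary. -/
def CohomIsZero (k : Type) [Field k] (Q : Quiv) (R : Set (Q.A × Q.A)) (m : ℕ) : Prop :=
  cocSp k Q R m ≤ cobSp k Q R m

/-- The degree-`m` cohomology `HH^m` of the complex `k(Γ ∥ B)` is
finite-dimensional: there is a finite set of cocycles whose classes span it. -/
def CohomFinDim (k : Type) [Field k] (Q : Quiv) (R : Set (Q.A × Q.A)) (m : ℕ) : Prop :=
  ∃ G : Finset (Coch k Q R m), ↑G ⊆ (cocSp k Q R m : Set (Coch k Q R m)) ∧
    cocSp k Q R m ≤ cobSp k Q R m ⊔ Submodule.span k ↑G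

/-- The degree-`m` cohomology `HH^m` of the complex `k(Γ ∥ B)` has dimension at
most `n`: there are `n` cocycles whose classes span it. -/
def CohomDimLe (k : Type) [Field k] (Q : Quiv) (R : Set (Q.A × Q.A)) (m n : ℕ) : Prop :=
  ∃ G : Finset (Coch k Q R m), G.card ≤ n ∧
    ↑G ⊆ (cocSp k Q R m : Set (Coch k Q R m)) ∧
    cocSp k Q R m ≤ cobSp k Q R m ⊔ Submodule.span k ↑G

/-- `Gen` is a basis of the kernel of `d⁰`, i.e. it freely generates `HH⁰`. -/
def FreelyGeneratesKer0 (k : Type) [Field k] (Q : Quiv) (R : Set (Q.A × Q.A))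
    (Gen : Set (Coch k Q R 0)) : Prop :=
  (∀ x ∈ Gen, dLin k Q R 0 x = 0) ∧
  (∀ z : Coch k Q R 0, dLin k Q R 0 z = 0 → z ∈ Submodule.span k Gen) ∧
  LinearIndependent k (fun x : Gen => (x : Coch k Q R 0))

/-- The cohomology classes of the elements of `Gen` freely generate the
degree-`(m+1)` cohomology of `k(Γ ∥ B)`: all elements of `Gen` are cocycles,
every cocycle is congruent to an element of their span modulo coboundaries, no
nonzero element of their span is a coboundary, and `Gen` is linearly
independent. -/
def FreelyGeneratesCohom (k : Type) [Field k] (Q : Quiv) (R : Set (Q.A × Q.A)) (m : ℕ)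
    (Gen : Set (Coch k Q R (m + 1))) : Prop :=
  (∀ x ∈ Gen, dLin k Q R (m + 1) x = 0) ∧
  (∀ z : Coch k Q R (m + 1), dLin k Q R (m + 1) z = 0 →
      ∃ y : Coch k Q R m, z - dLin k Q R m y ∈ Submodule.span k Gen) ∧
  (∀ x ∈ Submodule.span k Gen, x ∈ LinearMap.range (dLin k Q R m) → x = 0) ∧
  LinearIndependent k (fun x : Gen => (x : Coch k Q R (m + 1)))

/-! ### The chain complex `k(B ⊙ Γ)` -/

/-- Membership in the degree-`m` basis `B ⊙ Γ_m` of the chain complex. -/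
def BGmem (Q : Quiv) (R : Set (Q.A × Q.A)) (m : ℕ) (x : PathDat Q × PathDat Q) : Prop :=
  InB Q R x.1 ∧ InG Q R x.2 ∧ plen Q x.2 = m ∧ AntiPar Q x.1 x.2

abbrev BGt (Q : Quiv) (R : Set (Q.A × Q.A)) (m : ℕ) :=
  {x : PathDat Q × PathDat Q // BGmem Q R m x}

/-- The degree-`m` component of the chain complex `k(B ⊙ Γ)`. -/
abbrev Chn (k : Type) [Field k] (Q : Quiv) (R : Set (Q.A × Q.A)) (m : ℕ) :=
  BGt Q R m →₀ k

/-- The basis vector of `k(B ⊙ Γ_m)` attached to a raw pair of path data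
(and `0` if the pair is not in `B ⊙ Γ_m`). -/
noncomputable def bw (k : Type) [Field k] (Q : Quiv) (R : Set (Q.A × Q.A)) (m : ℕ)
    (x : PathDat Q × PathDat Q) : Chn k Q R m := by
  classical
  exact if h : BGmem Q R m x then Finsupp.single (⟨x, h⟩ : BGt Q R m) (1 : k) else 0

/-- `l1(p)`: the last arrow of `p` (as a path of length one). -/
def l1P (Q : Quiv) (p : PathDat Q) : PathDat Q :=
  match p.2.getLast? with
  | none => p
  | some a => (Q.src a, [a])

/-- `l2(p)`: `p` with its last arrow removed. -/
def l2P (Q : Quiv) (p : PathDat Q) : PathDat Q := (p.1, p.2.dropLast)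

/-- `r1(p)`: `p` with its first arrow removed. -/
def r1P (Q : Quiv) (p : PathDat Q) : PathDat Q :=
  match p.2 with
  | [] => p
  | a :: l => (Q.tgt a, l)

/-- `r2(p)`: the first arrow of `p` (as a path of length one). -/
def r2P (Q : Quiv) (p : PathDat Q) : PathDat Q :=
  match p.2 with
  | [] => p
  | a :: _ => (Q.src a, [a])

/-- The raw first term `(α·l1(γ), l2(γ))` of the boundary of `(α, γ)`. -/
def d1raw (Q : Quiv) (x : PathDat Q × PathDat Q) : PathDat Q × PathDat Q :=
  match x.2.2.getLast? with
  | none => x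
  | some a => ((Q.src a, a :: x.1.2), (x.2.1, x.2.2.dropLast))

/-- The raw second term `(r2(γ)·α, r1(γ))` of the boundary of `(α, γ)`. -/
def d2raw (Q : Quiv) (x : PathDat Q × PathDat Q) : PathDat Q × PathDat Q :=
  match x.2.2 with
  | [] => x
  | c :: l => ((x.1.1, x.1.2 ++ [c]), (Q.tgt c, l))

/-- The boundary of a basis element:
`d_m (α, γ) = (α·l1(γ), l2(γ)) + (-1)^m (r2(γ)·α, r1(γ))` (in degree `m = m+1`),
where pairs whose first component is not in `B` are interpreted as `0`. -/
noncomputable def bdB (k : Type) [Field k] (Q : Quiv) (R : Set (Q.A × Q.A)) (m : ℕ)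
    (x : BGt Q R (m + 1)) : Chn k Q R m :=
  bw k Q R m (d1raw Q x.val) + ((-1 : k) ^ (m + 1)) • bw k Q R m (d2raw Q x.val)

/-- The boundary map `d_{m+1} : k(B ⊙ Γ_{m+1}) → k(B ⊙ Γ_m)`. -/
noncomputable def bd (k : Type) [Field k] (Q : Quiv) (R : Set (Q.A × Q.A)) (m : ℕ) :
    Chn k Q R (m + 1) →ₗ[k] Chn k Q R m :=
  Finsupp.linearCombination k (bdB k Q R m)

/-- The subspace of cycles in degree `m` (everything in degree `0`). -/
noncomputable def ZSp (k : Type) [Field k] (Q : Quiv) (R : Set (Q.A × Q.A)) :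
    (m : ℕ) → Submodule k (Chn k Q R m)
  | 0 => ⊤
  | m + 1 => LinearMap.ker (bd k Q R m)

/-- The subspace of boundaries in degree `m`. -/
noncomputable def BSp (k : Type) [Field k] (Q : Quiv) (R : Set (Q.A × Q.A)) (m : ℕ) :
    Submodule k (Chn k Q R m) :=
  LinearMap.range (bd k Q R m)

/-- The degree-`m` homology `HH_m` of the complex `k(B ⊙ Γ)` vanishes:
every cycle is a boundary. -/
def HomIsZero (k : Type) [Field k] (Q : Quiv) (R : Set (Q.A × Q.A)) (m : ℕ) : Prop :=
  ZSp k Q R m ≤ BSp k Q R m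

/-- The degree-`m` homology `HH_m` of the complex `k(B ⊙ Γ)` is
finite-dimensional: there is a finite set of cycles whose classes span it. -/
def HomFinDim (k : Type) [Field k] (Q : Quiv) (R : Set (Q.A × Q.A)) (m : ℕ) : Prop :=
  ∃ G : Finset (Chn k Q R m), ↑G ⊆ (ZSp k Q R m : Set (Chn k Q R m)) ∧
    ZSp k Q R m ≤ BSp k Q R m ⊔ Submodule.span k ↑G

/-- The concatenation `α γ` of an antiparallel pair (a cycle, or a trivial path). -/
def concatP (Q : Quiv) (x : PathDat Q × PathDat Q) : PathDat Q := (x.2.1, x.2.2 ++ x.1.2)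

/-- The degree-`m` component of the subcomplex `k(B ⊙ Γ)_C`, spanned by the
basis elements whose concatenation lies in the circuit (rotation class) of `c`. -/
noncomputable def Wsp (k : Type) [Field k] (Q : Quiv) (R : Set (Q.A × Q.A))
    (c : PathDat Q) (m : ℕ) : Submodule k (Chn k Q R m) :=
  Submodule.span k {z : Chn k Q R m |
    ∃ x : BGt Q R m, RotEquiv Q (concatP Q x.val) c ∧ z = Finsupp.single x (1 : k)}

/-- The boundaries of the subcomplex `k(B ⊙ Γ)_C` in degree `m`. -/
noncomputable def WB (k : Type) [Field k] (Q : Quiv) (R : Set (Q.A × Q.A))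
    (c : PathDat Q) (m : ℕ) : Submodule k (Chn k Q R m) :=
  Submodule.map (bd k Q R m) (Wsp k Q R c (m + 1))

/-- The cycles of the subcomplex `k(B ⊙ Γ)_C` in degree `m`. -/
noncomputable def WZ (k : Type) [Field k] (Q : Quiv) (R : Set (Q.A × Q.A))
    (c : PathDat Q) (m : ℕ) : Submodule k (Chn k Q R m) :=
  ZSp k Q R m ⊓ Wsp k Q R c m

/-- The degree-`m` homology of `k(B ⊙ Γ)_C` is one-dimensional, spanned by the
homology class of `v`. -/
def SubHomSpannedBy (k : Type) [Field k] (Q : Quiv) (R : Set (Q.A × Q.A))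
    (c : PathDat Q) (m : ℕ) (v : Chn k Q R m) : Prop :=
  v ∈ WZ k Q R c m ∧ v ∉ WB k Q R c m ∧
  ∀ z ∈ WZ k Q R c m, ∃ t : k, z - t • v ∈ WB k Q R c m

/-- `ĥ(c) = Σ_{i=0}^{r-1} (r1(rot^i c), r2(rot^i c))` (degree 1, for cocomplete cycles;
placed in degree `m`). -/
noncomputable def hCycR (k : Type) [Field k] (Q : Quiv) (R : Set (Q.A × Q.A)) (m : ℕ)
    (c : PathDat Q) : Chn k Q R m :=
  ∑ i ∈ Finset.range (periodP Q c),
    bw k Q R m (r1P Q (rotI Q i c), r2P Q (rotI Q i c))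

/-- `ĥ(c) = Σ_{i=0}^{r-1} (-1)^{(m+1) i} (s(rot^i c), rot^i c)` (degree `m`, for
complete cycles of length `m`). -/
noncomputable def hCycM (k : Type) [Field k] (Q : Quiv) (R : Set (Q.A × Q.A)) (m : ℕ)
    (c : PathDat Q) : Chn k Q R m :=
  ∑ i ∈ Finset.range (periodP Q c),
    ((-1 : k) ^ ((m + 1) * i)) • bw k Q R m ((psrc Q (rotI Q i c), []), rotI Q i c)

/-- The homology classes of the elements of `Gen` freely generate the degree-`m`
homology of `k(B ⊙ Γ)`. -/
def FreelyGeneratesHom (k : Type) [Field k] (Q : Quiv) (R : Set (Q.A × Q.A)) (m : ℕ)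
    (Gen : Set (Chn k Q R m)) : Prop :=
  (∀ x ∈ Gen, x ∈ ZSp k Q R m) ∧
  (∀ z ∈ ZSp k Q R m, ∃ y : Chn k Q R (m + 1), z - bd k Q R m y ∈ Submodule.span k Gen) ∧
  (∀ x ∈ Submodule.span k Gen, x ∈ LinearMap.range (bd k Q R m) → x = 0) ∧
  LinearIndependent k (fun x : Gen => (x : Chn k Q R m))

section aux

theorem powL_chain {α : Type} (S : α → α → Prop) (l : List α) (h : l.IsChain S)
    (hc : ∀ a ∈ l.getLast?, ∀ b ∈ l.head?, S a b) (n : ℕ) : (powL l n).IsChain S := by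
  cases hl : l with
  | nil =>
    have : powL ([] : List α) n = [] := by induction n <;> simp_all [powL]
    rw [this]; exact List.IsChain.nil
  | cons x t =>
    rw [← hl]
    have key : (powL l n).IsChain S ∧ ∀ b ∈ (powL l n).head?, b ∈ l.head? := by
      induction n with
      | zero => simp [powL]
      | succ n ih =>
        refine ⟨?_, ?_⟩
        · simp only [powL]
          rw [List.isChain_append]
          exact ⟨h, ih.1, fun a ha b hb => hc a ha b (ih.2 b hb)⟩
        · simp [powL, hl]
    exact key.1

theorem ok_of_chain (Q : Quiv) (a : Q.A) (l : List Q.A)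
    (h : (a :: l).IsChain (fun a b => Q.tgt a = Q.src b)) : Ok Q (Q.src a, a :: l) :=
  ⟨h, by simp⟩

theorem complete_of (Q : Quiv) (R : Set (Q.A × Q.A)) (hq : IsQuadMon Q R)
    (l : List Q.A) (hl : l ≠ []) (h : l.IsChain (fun a b => (a, b) ∈ R))
    (hc : ∀ a ∈ l.getLast?, ∀ b ∈ l.head?, (a, b) ∈ R) : ∃ C, Complete Q R C := by
  obtain ⟨x, t, rfl⟩ := List.exists_cons_of_ne_nil hl
  have h2 := powL_chain _ _ h hc 2
  have e : powL (x :: t) 2 = x :: (t ++ x :: t) := by simp [powL]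
  refine ⟨(Q.src x, x :: t), ⟨ok_of_chain Q x t (h.imp fun a b hab => hq _ hab), hl, ?_⟩, ?_, h2⟩
  · have hlast := List.getLast?_eq_getLast_of_ne_nil hl
    have := hq _ (hc _ hlast x (by simp))
    simp only [psrc, ptgt, hlast, Option.elim]
    exact this.symm
  · simp only [powP]
    rw [e] at h2 ⊢
    exact ok_of_chain Q x _ (h2.imp fun a b hab => hq _ hab)

theorem length_powL {α : Type} (l : List α) (n : ℕ) : (powL l n).length = n * l.length := by
  induction n with
  | zero => simp [powL]
  | succ n ih => simp [powL, ih]; ring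

theorem no_cocomplete (Q : Quiv) (R : Set (Q.A × Q.A))
    (hfin : {p : PathDat Q | InB Q R p}.Finite)
    (l : List Q.A) (hl : l ≠ []) (h : l.IsChain (fun a b => Q.tgt a = Q.src b ∧ (a, b) ∉ R))
    (hc : ∀ a ∈ l.getLast?, ∀ b ∈ l.head?, Q.tgt a = Q.src b ∧ (a, b) ∉ R) : False := by
  obtain ⟨x, t, rfl⟩ := List.exists_cons_of_ne_nil hl
  refine Set.infinite_of_injective_forall_mem (f := fun n : ℕ => (Q.src x, powL (x :: t) n))
    ?_ ?_ hfin
  · intro n n' hn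
    have := congrArg (fun p => p.2.length) hn
    simpa [length_powL] using this
  · intro n
    have h2 := powL_chain _ _ h hc n
    refine ⟨⟨h2.imp fun a b hab => hab.1, ?_⟩, h2.imp fun a b hab => hab.2⟩
    cases n <;> simp [powL]

/-- membership unfolded -/
theorem BGmem_iff (Q : Quiv) (R : Set (Q.A × Q.A)) (m : ℕ) (v w : Q.V) (as gs : List Q.A) :
    BGmem Q R m ((v, as), (w, gs)) ↔
      ((as.IsChain (fun a b => Q.tgt a = Q.src b) ∧ ∀ a ∈ as.head?, Q.src a = v) ∧
        as.IsChain (fun a b => (a, b) ∉ R)) ∧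
      ((gs.IsChain (fun a b => Q.tgt a = Q.src b) ∧ ∀ a ∈ gs.head?, Q.src a = w) ∧
        gs.IsChain (fun a b => (a, b) ∈ R)) ∧
      gs.length = m ∧ v = gs.getLast?.elim w Q.tgt ∧ as.getLast?.elim v Q.tgt = w := Iff.rfl

theorem L1 (Q : Quiv) (R : Set (Q.A × Q.A)) (m : ℕ) (v w : Q.V)
    (as gs : List Q.A) (g : Q.A) (hx : BGmem Q R (m + 1) ((v, as), (w, gs ++ [g]))) :
    BGmem Q R m ((Q.src g, g :: as), (w, gs)) ↔ ∀ a ∈ as.head?, (g, a) ∉ R := by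
  rw [BGmem_iff] at *
  cases as <;> cases gs using List.reverseRecOn <;>
    simp_all [List.isChain_append, List.isChain_cons] <;> grind

theorem L2 (Q : Quiv) (R : Set (Q.A × Q.A)) (m : ℕ) (v w : Q.V)
    (as gs : List Q.A) (g : Q.A) (hx : BGmem Q R (m + 1) ((v, as), (w, g :: gs))) :
    BGmem Q R m ((v, as ++ [g]), (Q.tgt g, gs)) ↔ ∀ a ∈ as.getLast?, (a, g) ∉ R := by
  rw [BGmem_iff] at *
  cases as using List.reverseRecOn <;> cases gs <;>
    simp_all [List.isChain_append, List.isChain_cons] <;> grind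

theorem L3 (Q : Quiv) (R : Set (Q.A × Q.A)) (m : ℕ) (v w : Q.V)
    (as gs : List Q.A) (a : Q.A) (hx : BGmem Q R m ((v, a :: as), (w, gs))) :
    BGmem Q R (m + 1) ((Q.tgt a, as), (w, gs ++ [a])) ↔ ∀ g ∈ gs.getLast?, (g, a) ∈ R := by
  rw [BGmem_iff] at *
  cases as <;> cases gs using List.reverseRecOn <;>
    simp_all [List.isChain_append, List.isChain_cons] <;> grind

/-- raw homotopy -/
noncomputable def hB (k : Type) [Field k] (Q : Quiv) (R : Set (Q.A × Q.A)) (m : ℕ)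
    (x : PathDat Q × PathDat Q) : Chn k Q R (m + 1) :=
  match x.1.2 with
  | [] => 0
  | a :: l => bw k Q R (m + 1) ((Q.tgt a, l), (x.2.1, x.2.2 ++ [a]))

noncomputable def hL (k : Type) [Field k] (Q : Quiv) (R : Set (Q.A × Q.A)) (m : ℕ) :
    Chn k Q R m →ₗ[k] Chn k Q R (m + 1) :=
  Finsupp.linearCombination k (fun x : BGt Q R m => hB k Q R m x.val)

theorem bw_pos (k : Type) [Field k] (Q : Quiv) (R : Set (Q.A × Q.A)) (m : ℕ)
    (x : PathDat Q × PathDat Q) (h : BGmem Q R m x) :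
    bw k Q R m x = Finsupp.single (⟨x, h⟩ : BGt Q R m) (1 : k) := by
  simp [bw, h]

theorem bw_neg (k : Type) [Field k] (Q : Quiv) (R : Set (Q.A × Q.A)) (m : ℕ)
    (x : PathDat Q × PathDat Q) (h : ¬ BGmem Q R m x) : bw k Q R m x = 0 := by
  simp [bw, h]

theorem hL_pos (k : Type) [Field k] (Q : Quiv) (R : Set (Q.A × Q.A)) (m : ℕ)
    (x : PathDat Q × PathDat Q) (h : BGmem Q R m x) :
    hL k Q R m (bw k Q R m x) = hB k Q R m x := by
  simp [bw_pos k Q R m x h, hL]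

theorem bd_pos (k : Type) [Field k] (Q : Quiv) (R : Set (Q.A × Q.A)) (m : ℕ)
    (x : PathDat Q × PathDat Q) (h : BGmem Q R (m + 1) x) :
    bd k Q R m (bw k Q R (m + 1) x) =
      bw k Q R m (d1raw Q x) + ((-1 : k) ^ (m + 1)) • bw k Q R m (d2raw Q x) := by
  simp [bw_pos k Q R (m + 1) x h, bd, bdB]

theorem d1raw_append (Q : Quiv) (p : PathDat Q) (w : Q.V) (gs : List Q.A) (g : Q.A) :
    d1raw Q (p, (w, gs ++ [g])) = ((Q.src g, g :: p.2), (w, gs)) := by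
  simp [d1raw]

theorem d2raw_cons (Q : Quiv) (p : PathDat Q) (w : Q.V) (gs : List Q.A) (g : Q.A) :
    d2raw Q (p, (w, g :: gs)) = ((p.1, p.2 ++ [g]), (Q.tgt g, gs)) := by
  simp [d2raw]

theorem homotopy (k : Type) [Field k] (Q : Quiv) (R : Set (Q.A × Q.A)) (hq : IsQuadMon Q R)
    (hfin : {p : PathDat Q | InB Q R p}.Finite) (hno : ¬∃ C : PathDat Q, Complete Q R C)
    (m : ℕ) (x : PathDat Q × PathDat Q) (hx : BGmem Q R (m + 1) x) :
    bd k Q R (m + 1) (hB k Q R (m + 1) x) +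
      hL k Q R m (bw k Q R m (d1raw Q x) + ((-1 : k) ^ (m + 1)) • bw k Q R m (d2raw Q x)) =
      bw k Q R (m + 1) x := by
  obtain ⟨⟨v, as⟩, ⟨w, gs⟩⟩ := x
  have hx' := (BGmem_iff Q R _ _ _ _ _).1 hx
  obtain ⟨⟨⟨ha1, ha2⟩, ha3⟩, ⟨⟨hg1, hg2⟩, hg3⟩, hlen, hv, hw⟩ := hx'
  have hne : gs ≠ [] := by rintro rfl; simp at hlen
  obtain ⟨g, gs'', hgc⟩ := List.exists_cons_of_ne_nil hne
  obtain ⟨gs', g', hga⟩ : ∃ gs' g', gs = gs' ++ [g'] :=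
    ⟨gs.dropLast, gs.getLast hne, (List.dropLast_append_getLast hne).symm⟩
  have hv' : Q.tgt g' = v := by simp [hv, hga]
  have e1 : d1raw Q ((v, as), (w, gs)) = ((Q.src g', g' :: as), (w, gs')) := by
    rw [hga, d1raw_append]
  have e2 : d2raw Q ((v, as), (w, gs)) = ((v, as ++ [g]), (Q.tgt g, gs'')) := by
    rw [hgc, d2raw_cons]
  have M1 := L1 Q R m v w as gs' g' (hga ▸ hx)
  have M2 := L2 Q R m v w as gs'' g (hgc ▸ hx)
  rw [e1, e2, map_add, map_smul]
  have glast : gs.getLast? = some g' := by simp [hga]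
  have ghead : gs.head? = some g := by simp [hgc]
  have glast'' : gs'' ≠ [] → gs''.getLast? = some g' := by
    intro h
    rw [← glast, hgc]
    cases gs'' with
    | nil => exact absurd rfl h
    | cons b t => simp
  have gone : gs'' = [] → g' = g := by
    rintro rfl
    rw [hgc] at glast
    simpa using glast.symm
  have hd1 : (∀ a ∈ as.head?, (g', a) ∉ R) →
      hL k Q R m (bw k Q R m ((Q.src g', g' :: as), (w, gs'))) =
        bw k Q R (m + 1) ((v, as), (w, gs)) := by
    intro h
    rw [hL_pos _ _ _ _ _ (M1.2 h)]
    simp only [hB]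
    rw [hv', ← hga]
  cases as with
  | nil =>
    rw [hd1 (by simp)]
    have m2 := M2.2 (by simp)
    rw [hL_pos _ _ _ _ _ m2]
    have M3 := L3 Q R m v (Q.tgt g) [] gs'' g m2
    have : ¬ BGmem Q R (m + 1) ((Q.tgt g, []), (Q.tgt g, gs'' ++ [g])) := by
      rw [M3]
      intro h
      have hg'g : (g', g) ∈ R := by
        by_cases h0 : gs'' = []
        · have := gone h0
          subst this
          by_contra hn
          refine no_cocomplete Q R hfin [g'] (by simp) (by simp) ?_
          simp only [List.getLast?_singleton, List.head?_cons, Option.mem_def, Option.some.injEq,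
            forall_eq']
          refine ⟨?_, hn⟩
          rw [hv', hg2 g' ghead]
          simpa using hw
        · exact h _ (glast'' h0)
      refine hno (complete_of Q R hq gs hne hg3 ?_)
      rw [glast, ghead]
      simpa using hg'g
    simp only [hB, List.nil_append]
    rw [bw_neg _ _ _ _ _ this]
    simp
  | cons a l =>
    have hsa : Q.src a = v := ha2 a (by simp)
    have M3 := L3 Q R (m + 1) v w l gs a hx
    rw [glast] at M3
    simp only [Option.mem_def, Option.some.injEq, forall_eq'] at M3
    have hBx : hB k Q R (m + 1) ((v, a :: l), (w, gs)) =
      bw k Q R (m + 1 + 1) ((Q.tgt a, l), (w, gs ++ [a])) := rfl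
    rw [hBx]
    by_cases hR : (g', a) ∈ R
    · have m1 : ¬ BGmem Q R m ((Q.src g', g' :: a :: l), (w, gs')) := by
        rw [M1]; simpa using hR
      have m3 := M3.2 hR
      rw [bw_neg _ _ _ _ _ m1, bd_pos _ _ _ _ _ m3, d1raw_append]
      simp only [hgc, List.cons_append, d2raw_cons, hsa]
      have m3' := m3
      rw [hgc, List.cons_append] at m3'
      have M4 := L2 Q R (m + 1) _ _ _ _ _ m3'
      have hiff : BGmem Q R (m + 1) ((Q.tgt a, l ++ [g]), (Q.tgt g, gs'' ++ [a])) ↔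
          BGmem Q R m ((v, a :: l ++ [g]), (Q.tgt g, gs'')) := by
        rw [M4, M2]
        cases l with
        | cons b t => simp
        | nil =>
          simp only [List.getLast?_nil, Option.mem_def, List.getLast?_singleton,
            Option.some.injEq, forall_eq']
          refine ⟨fun _ hag => ?_, by simp⟩
          refine hno (complete_of Q R hq (gs ++ [a]) (by simp) ?_ ?_)
          · rw [List.isChain_append]
            refine ⟨hg3, by simp, ?_⟩
            rw [glast]; simpa using hR
          · rw [List.getLast?_concat, hgc]
            simpa using hag
      by_cases h2 : BGmem Q R m ((v, a :: l ++ [g]), (Q.tgt g, gs''))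
      · have : hL k Q R m (bw k Q R m ((v, a :: (l ++ [g])), (Q.tgt g, gs''))) =
          bw k Q R (m + 1) ((Q.tgt a, l ++ [g]), (Q.tgt g, gs'' ++ [a])) :=
          hL_pos _ _ _ _ _ h2
        rw [this, pow_succ]
        simp
      · rw [bw_neg k Q R (m + 1) _ (fun h => h2 (hiff.1 h))]
        rw [List.cons_append] at h2
        rw [bw_neg k Q R m _ h2]
        simp
    · rw [bw_neg _ _ _ _ _ (fun h => hR (M3.1 h)), hd1 (by simpa using hR)]
      by_cases h2 : BGmem Q R m ((v, a :: l ++ [g]), (Q.tgt g, gs''))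
      · rw [hL_pos _ _ _ _ _ h2]
        have : hB k Q R m ((v, a :: l ++ [g]), (Q.tgt g, gs'')) =
          bw k Q R (m + 1) ((Q.tgt a, l ++ [g]), (Q.tgt g, gs'' ++ [a])) := rfl
        rw [this, bw_neg k Q R (m + 1) ((Q.tgt a, l ++ [g]), (Q.tgt g, gs'' ++ [a]))]
        · simp
        · rw [L3 Q R m v (Q.tgt g) (l ++ [g]) gs'' a h2]
          intro h
          by_cases h0 : gs'' = []
          · have := gone h0
            subst this
            have h3 := ((BGmem_iff Q R _ _ _ _ _).1 h2).1
            refine no_cocomplete Q R hfin (a :: l ++ [g']) (by simp) ?_ ?_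
            · have c1 : List.IsChain _ _ := h3.1.1
              have c2 : List.IsChain _ _ := h3.2
              rw [List.isChain_iff_getElem] at c1 c2 ⊢
              exact fun i hi => ⟨c1 i hi, c2 i hi⟩
            · rw [List.getLast?_concat]
              simp [hsa, hv', hR]
          · exact hR (h _ (glast'' h0))
      · rw [bw_neg _ _ _ _ _ h2]
        simp

theorem vanish (k : Type) [Field k] (Q : Quiv) (R : Set (Q.A × Q.A)) (hq : IsQuadMon Q R)
    (hfin : {p : PathDat Q | InB Q R p}.Finite) (hno : ¬∃ C : PathDat Q, Complete Q R C)
    (m : ℕ) : HomIsZero k Q R (m + 1) := by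
  have key : bd k Q R (m + 1) ∘ₗ hL k Q R (m + 1) + hL k Q R m ∘ₗ bd k Q R m =
      LinearMap.id := by
    apply Finsupp.lhom_ext'
    intro x
    ext1
    have := homotopy k Q R hq hfin hno m x.1 x.2
    rw [← bd_pos k Q R m _ x.2, ← hL_pos k Q R (m + 1) _ x.2, bw_pos k Q R (m + 1) _ x.2] at this
    simpa using this
  intro z hz
  have hz' : bd k Q R m z = 0 := hz
  refine ⟨hL k Q R (m + 1) z, ?_⟩
  have := LinearMap.congr_fun key z
  simpa [hz'] using this

theorem exists_periodic (Q : Quiv) (R : Set (Q.A × Q.A)) (C : PathDat Q)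
    (hC : Complete Q R C) : ∃ ℓ : ℕ, 0 < ℓ ∧ ∃ c : ℕ → Q.A, (∀ i, c (i + ℓ) = c i) ∧
      ∀ i, (c i, c (i + 1)) ∈ R := by
  obtain ⟨⟨-, hne, -⟩, -, h⟩ := hC
  have hpos : 0 < C.2.length := List.length_pos_iff.2 hne
  refine ⟨C.2.length, hpos, fun i => C.2[i % C.2.length]'(Nat.mod_lt _ hpos), by simp, ?_⟩
  intro i
  have h' : (C.2 ++ C.2).IsChain (fun a b => (a, b) ∈ R) := by
    have e : (powP Q C 2).2 = C.2 ++ C.2 := by simp [powP, powL]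
    rw [e] at h
    exact h
  rw [List.isChain_iff_getElem] at h'
  have hi := Nat.mod_lt i hpos
  have := h' (i % C.2.length) (by simp; omega)
  rw [List.getElem_append_left hi] at this
  have e : (i + 1) % C.2.length = (i % C.2.length + 1) % C.2.length := by simp
  by_cases hlt : i % C.2.length + 1 < C.2.length
  · rw [List.getElem_append_left hlt] at this
    simp only [e, Nat.mod_eq_of_lt hlt]
    exact this
  · have heq : i % C.2.length + 1 = C.2.length := by omega
    rw [List.getElem_append_right (by omega)] at this
    simp only [e, heq, Nat.mod_self]
    simpa only [heq, Nat.sub_self] using this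

theorem exists_periodic_inj (Q : Quiv) (R : Set (Q.A × Q.A)) (C : PathDat Q)
    (hC : Complete Q R C) : ∃ ℓ : ℕ, 0 < ℓ ∧ ∃ c : ℕ → Q.A, (∀ i, c (i + ℓ) = c i) ∧
      (∀ i, (c i, c (i + 1)) ∈ R) ∧ ∀ i, 0 < i → i < ℓ → c i ≠ c 0 := by
  classical
  have h := exists_periodic Q R C hC
  obtain ⟨h0, c, hper, hR⟩ := Nat.find_spec h
  refine ⟨Nat.find h, h0, c, hper, hR, ?_⟩
  intro i hi hlt heq
  refine Nat.find_min h hlt ⟨hi, fun n => c (n % i), by simp, ?_⟩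
  intro n
  have hn := Nat.mod_lt n hi
  have e : (n + 1) % i = (n % i + 1) % i := by simp
  have := hR (n % i)
  by_cases hlt : n % i + 1 < i
  · simp only [e, Nat.mod_eq_of_lt hlt]; exact this
  · have h1 : n % i + 1 = i := by omega
    simp only [e, h1, Nat.mod_self]
    rwa [h1, heq] at this

/-- the `i`-th rotation as an element of the complex -/
def xr (Q : Quiv) (c : ℕ → Q.A) (m i : ℕ) : PathDat Q × PathDat Q :=
  ((Q.src (c i), []), (Q.src (c i), (List.range m).map (fun j => c (i + j))))

theorem bd_empty (k : Type) [Field k] (Q : Quiv) (R : Set (Q.A × Q.A)) (m : ℕ)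
    (x : BGt Q R m) (hx : x.1.1.2 = []) (y : Chn k Q R (m + 1)) : bd k Q R m y x = 0 := by
  have : Finsupp.lapply x ∘ₗ bd k Q R m = 0 := by
    apply Finsupp.lhom_ext'
    intro z
    ext1
    obtain ⟨⟨⟨v, as⟩, ⟨w, gs⟩⟩, hz⟩ := z
    have hne : gs ≠ [] := by
      rintro rfl
      have := ((BGmem_iff Q R _ _ _ _ _).1 hz).2.2.1
      simp at this
    have hbw : ∀ y : PathDat Q × PathDat Q, y.1.2 ≠ [] → bw k Q R m y x = 0 := by
      intro y hy
      by_cases hm : BGmem Q R m y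
      · rw [bw_pos _ _ _ _ _ hm, Finsupp.single_apply, if_neg]
        rintro rfl
        exact hy hx
      · rw [bw_neg _ _ _ _ _ hm]; rfl
    have h1 := bd_pos k Q R m _ hz
    rw [bw_pos k Q R _ _ hz] at h1
    simp only [LinearMap.comp_apply, Finsupp.lsingle_apply, h1, Finsupp.lapply_apply,
      Finsupp.add_apply, Finsupp.smul_apply, LinearMap.zero_comp, LinearMap.zero_apply]
    rw [hbw, hbw]
    · simp
    · obtain ⟨g, t, rfl⟩ := List.exists_cons_of_ne_nil hne
      simp [d2raw]
    · rw [← List.dropLast_append_getLast hne, d1raw_append]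
      simp
  exact LinearMap.congr_fun this y

theorem xr_mem (Q : Quiv) (R : Set (Q.A × Q.A)) (hq : IsQuadMon Q R) (c : ℕ → Q.A)
    (hR : ∀ i, (c i, c (i + 1)) ∈ R) (M : ℕ) (hper : ∀ i, c (i + (M + 1)) = c i) (i : ℕ) :
    BGmem Q R (M + 1) (xr Q c (M + 1) i) := by
  have hch : ((List.range (M + 1)).map (fun j => c (i + j))).IsChain (fun a b => (a, b) ∈ R) := by
    rw [List.isChain_iff_getElem]
    intro j hj
    simpa [add_assoc] using hR (i + j)
  refine (BGmem_iff Q R _ _ _ _ _).2 ⟨by simp, ⟨⟨hch.imp fun a b hab => hq _ hab, ?_⟩, hch⟩,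
    by simp, ?_, by simp⟩
  · simp [List.range_succ_eq_map]
  · have := hq _ (hR (i + M))
    simp only at this
    rw [add_assoc, hper] at this
    simp [List.range_succ, this]

theorem nonvanish (k : Type) [Field k] (Q : Quiv) (R : Set (Q.A × Q.A)) (hq : IsQuadMon Q R)
    (C : PathDat Q) (hC : Complete Q R C) (m₀ : ℕ) : ∃ m, m₀ ≤ m ∧ ¬ HomIsZero k Q R m := by
  obtain ⟨ℓ, hl, c, hper, hR, hinj⟩ := exists_periodic_inj Q R C hC
  have hpern : ∀ n i, c (i + n * ℓ) = c i := by
    intro n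
    induction n with
    | zero => simp
    | succ n ih => intro i; rw [add_mul, ← add_assoc, one_mul, hper, ih]
  obtain ⟨M, hM⟩ : ∃ M, (2 * m₀ + 1) * ℓ = M + 1 :=
    ⟨(2 * m₀ + 1) * ℓ - 1, by have : 0 < (2 * m₀ + 1) * ℓ := by positivity
                              omega⟩
  have hperM : ∀ i, c (i + (M + 1)) = c i := hM ▸ hpern _
  have hmem := xr_mem Q R hq c hR M hperM
  refine ⟨M + 1, by nlinarith, fun hz => ?_⟩
  let s : k := (-1) ^ (M + 1 + 1)
  have hss : s * s = 1 := by
    simp only [s, ← pow_add]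
    exact Even.neg_one_pow ⟨_, rfl⟩
  have hsl : s ^ ℓ = 1 := by
    simp only [s, ← pow_mul]
    apply Even.neg_one_pow
    rw [← hM]
    rcases Nat.even_or_odd ℓ with h | h
    · exact h.mul_left _
    · apply Even.mul_right
      exact ((odd_two_mul_add_one m₀).mul h).add_one
  let z : Chn k Q R (M + 1) :=
    ∑ i ∈ Finset.range ℓ, s ^ i • bw k Q R (M + 1) (xr Q c (M + 1) i)
  let A : ℕ → Chn k Q R M := fun i => bw k Q R M (d1raw Q (xr Q c (M + 1) i))
  have hA : ∀ i, d1raw Q (xr Q c (M + 1) (i + 1)) = d2raw Q (xr Q c (M + 1) i) := by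
    intro i
    have e1 : xr Q c (M + 1) (i + 1) = ((Q.src (c (i + 1)), []), (Q.src (c (i + 1)),
      (List.range M).map (fun j => c (i + 1 + j)) ++ [c (i + 1 + M)])) := by
      simp [xr, List.range_succ]
    have e2 : xr Q c (M + 1) i = ((Q.src (c i), []), (Q.src (c i),
      c i :: (List.range M).map (fun j => c (i + (j + 1))))) := by
      simp [xr, List.range_succ_eq_map, Function.comp_def]
    rw [e1, e2, d1raw_append, d2raw_cons]
    have e4 : Q.tgt (c i) = Q.src (c (i + 1)) := hq _ (hR i)
    have e5 : ∀ j, i + 1 + j = i + (j + 1) := fun j => by ring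
    simp only [e4, e5, hperM, List.nil_append]
  have hxper : ∀ i, xr Q c (M + 1) (i + ℓ) = xr Q c (M + 1) i := by
    intro i
    have : ∀ j, c (i + ℓ + j) = c (i + j) := fun j => by
      rw [← hper (i + j)]; congr 1; ring
    simp [xr, hper, this]
  have hcyc : bd k Q R M z = 0 := by
    have hterm : ∀ i, bd k Q R M (s ^ i • bw k Q R (M + 1) (xr Q c (M + 1) i)) =
        -(s ^ (i + 1) • A (i + 1) - s ^ i • A i) := by
      intro i
      rw [map_smul, bd_pos k Q R M _ (hmem i), ← hA i]
      have e : ((-1 : k) ^ (M + 1)) = -s := by simp [s, pow_succ]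
      rw [e, pow_succ]
      simp only [A]
      module
    simp only [z, map_sum, hterm, Finset.sum_neg_distrib]
    rw [Finset.sum_range_sub (fun i => s ^ i • A i)]
    have : A ℓ = A 0 := by
      have := hxper 0
      rw [zero_add] at this
      simp only [A, this]
    simp [this, hsl]
  obtain ⟨y, hy⟩ := hz (show z ∈ ZSp k Q R (M + 1) from hcyc)
  have h0 := bd_empty k Q R (M + 1) ⟨_, hmem 0⟩ rfl y
  rw [hy] at h0
  have h1 : z ⟨_, hmem 0⟩ = 1 := by
    simp only [z, Finsupp.finset_sum_apply]
    rw [Finset.sum_eq_single 0]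
    · rw [bw_pos k Q R _ _ (hmem 0)]
      simp
    · intro i hi hi0
      rw [bw_pos k Q R _ _ (hmem i), Finsupp.smul_apply, Finsupp.single_apply, if_neg]
      · simp
      · intro he
        have he' : xr Q c (M + 1) i = xr Q c (M + 1) 0 := congrArg Subtype.val he
        have := congrArg (fun p => p.2.2.head?) he'
        simp [xr, List.range_succ_eq_map] at this
        exact hinj i (Nat.pos_of_ne_zero hi0) (Finset.mem_range.1 hi) this
    · intro h
      exact absurd (Finset.mem_range.2 hl) h
  rw [h1] at h0
  exact one_ne_zero h0

end aux

/-- For a quadratic monomial presentation `(Q, R)` with `B`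
finite, the following are equivalent: (i) there is no complete circuit
(equivalently, `kQ/⟨R⟩` has finite global dimension); (ii) `HH_m = 0` for all
`m ≥ 1`; (iii) `HH_m = 0` for all `m` large enough; (iv) the direct sum
`⊕_{m ≥ m₀} HH_m` is finite-dimensional for some `m₀` (i.e. for some `m₀` all
`HH_m` with `m ≥ m₀` are finite-dimensional and all but finitely many vanish). -/
theorem homology_vanishing_characterization (k : Type) [Field k] (Q : Quiv)
    (R : Set (Q.A × Q.A)) (hq : IsQuadMon Q R)
    (hfin : {p : PathDat Q | InB Q R p}.Finite) :
    ((¬∃ C : PathDat Q, Complete Q R C) ↔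
      (∀ m : ℕ, 1 ≤ m → HomIsZero k Q R m)) ∧
    ((¬∃ C : PathDat Q, Complete Q R C) ↔
      (∃ m₀ : ℕ, ∀ m : ℕ, m₀ ≤ m → HomIsZero k Q R m)) ∧
    ((¬∃ C : PathDat Q, Complete Q R C) ↔
      (∃ m₀ : ℕ, (∀ m : ℕ, m₀ ≤ m → HomFinDim k Q R m) ∧
        {m : ℕ | m₀ ≤ m ∧ ¬HomIsZero k Q R m}.Finite)) := by
  have h12 : (¬∃ C : PathDat Q, Complete Q R C) → ∀ m : ℕ, 1 ≤ m → HomIsZero k Q R m := by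
    intro hno m hm
    obtain ⟨n, rfl⟩ := Nat.exists_eq_add_of_le' hm
    exact vanish k Q R hq hfin hno n
  have h31 : (∃ m₀ : ℕ, ∀ m : ℕ, m₀ ≤ m → HomIsZero k Q R m) →
      ¬∃ C : PathDat Q, Complete Q R C := by
    rintro ⟨m₀, h⟩ ⟨C, hC⟩
    obtain ⟨m, hm, hz⟩ := nonvanish k Q R hq C hC m₀
    exact hz (h m hm)
  refine ⟨⟨h12, fun h => h31 ⟨1, h⟩⟩, ⟨fun h => ⟨1, h12 h⟩, h31⟩, ⟨fun h => ⟨1, ?_, ?_⟩, ?_⟩⟩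
  · intro m hm
    exact ⟨∅, by simp, le_sup_of_le_left (h12 h m hm)⟩
  · convert Set.finite_empty
    ext m
    simpa using h12 h m
  · rintro ⟨m₀, -, hf⟩
    obtain ⟨b, hb⟩ := hf.bddAbove
    refine h31 ⟨max m₀ (b + 1), fun m hm => ?_⟩
    by_contra hz
    have := hb ⟨(le_max_left _ _).trans hm, hz⟩
    have := (le_max_right _ _).trans hm
    omega

end GentleTT
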